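/- Let h be an exponential comparison function, let k > 0 and p ≥ 0 be real numbers, and for i ∈ ℕ define h_i: ℝ⁺ → ℝ⁺ by h_i(x) := h(((x − i)₊)⁴), where a₊ := max(a,0). Then there exist constants c_{k,p} (depending on k, p and h) and c_k (depending on k and h), but NOT on i, such that: |r|^p + |h(r)|^p + |h'(r)|^p + |h''(r)|^p ≤ c_{k,p} e^{k h(r)} for all r ∈ ℝ⁺; |h_i(y)| ≤ c_k e^{k h_i(y)} for all y ∈ ℝ⁺; |h_i'(y)| ≤ c_k e^{k h_i(y)} for all y ∈ ℝ⁺; and |h_i''(y)| ≤ c_k e^{k h_i(y)} for all y > i. -/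

import Mathlib

/-!
## Common abstract framework

Mathlib does not yet contain Riemannian metrics, curvature tensors, or the
Ricci flow.  We therefore model a complete smooth Riemannian manifold `(M,g)`
by the *abstract geometric data* it induces: the Riemannian distance function,
the volumes of metric balls, and the relevant pointwise curvature quantities
(least eigenvalue of the Ricci tensor, least sectional curvature, least
eigenvalue of the curvature operator, the norm `|Riem|` of the curvature
tensor, the scalar curvature), as well as the data of the Hessian of distance
functions and of the cut locus.  A solution `(M,g(t))_{t∈[0,T)}` of the Ricci
flow `∂g/∂t = -2 Ric(g(t))` is modelled as a one-parameter family
`g : ℝ → RMetric M` of such data (the flow equation itself concerns the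
unmodelled metric tensors).
-/

open Real Filter Set

noncomputable section

/-- The exponential function composed with itself `m` times. -/
def iterExp (m : ℕ) : ℝ → ℝ := Real.exp^[m]

/-- The topology induced by a distance function `d`, generated by the balls
`{y | d x y < r}`. -/
def distTopology {M : Type} (d : M → M → ℝ) : TopologicalSpace M :=
  TopologicalSpace.generateFrom {s | ∃ x r, s = {y | d x y < r}}

/-- Abstract geometric data of a complete smooth Riemannian manifold `(M,g)`. -/
structure RMetric (M : Type) : Type where
  /-- the Riemannian distance function induced by `g` -/
  dist : M → M → ℝ
  dist_self : ∀ x, dist x x = 0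
  dist_comm : ∀ x y, dist x y = dist y x
  dist_triangle : ∀ x y z, dist x z ≤ dist x y + dist y z
  eq_of_dist_eq_zero : ∀ x y, dist x y = 0 → x = y
  /-- `volBall x r` is the Riemannian volume of the metric ball `B_r(x)` -/
  volBall : M → ℝ → ℝ
  /-- the least eigenvalue of the Ricci tensor at `x` (so `Ric ≥ k ⋅ g` iff `k ≤ ricciLB x` everywhere) -/
  ricciLB : M → ℝ
  /-- the least sectional curvature at `x` -/
  secLB : M → ℝ
  /-- the least eigenvalue of the curvature operator at `x` -/
  curvOpLB : M → ℝ
  /-- the norm `|Riem|(x)` of the Riemann curvature tensor at `x` -/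
  riemNorm : M → ℝ
  /-- the scalar curvature `R(x)` -/
  scal : M → ℝ
  /-- `distSmoothOutside b R` : the distance function `ρ = dist(b,·)` is smooth on `M - B_R(b)` -/
  distSmoothOutside : M → ℝ → Prop
  /-- `hessDistUB b x` : the largest eigenvalue of the Hessian `∇²ρ` of `ρ = dist(b,·)` at `x`
  (so `∇²ρ ≤ k ⋅ g` at `x` iff `hessDistUB b x ≤ k`) -/
  hessDistUB : M → M → ℝ
  /-- `hessDistLB b x` : the smallest eigenvalue of `∇²ρ` at `x` restricted to the directions
  orthogonal to the minimizing geodesic from `b` to `x` -/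
  hessDistLB : M → M → ℝ
  /-- `hessDistNorm b x` : the norm `|∇²ρ|(x)` of the Hessian of `ρ = dist(b,·)` at `x` -/
  hessDistNorm : M → M → ℝ
  /-- `notCut b x` : `x` does not lie in the cut locus of `b` -/
  notCut : M → M → Prop

namespace RMetric

variable {M : Type}

/-- The metric ball `B_r(x)` of radius `r` about `x`. -/
def ball (g : RMetric M) (x : M) (r : ℝ) : Set M := {y | g.dist x y < r}

/-- The metric topology induced by `g`. -/
def topology (g : RMetric M) : TopologicalSpace M := distTopology g.dist

/-- `sup_{B_r(b)} |Riem(g)|`. -/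
def riemSupBall (g : RMetric M) (b : M) (r : ℝ) : ℝ := sSup (g.riemNorm '' g.ball b r)

/-- Condition (a): `Ric(g) ≥ k`. -/
def RicciGE (g : RMetric M) (k : ℝ) : Prop := ∀ x, k ≤ g.ricciLB x

/-- Condition (b): `vol(B_1(x)) ≥ v₀` for all `x ∈ M`. -/
def VolGE (g : RMetric M) (v₀ : ℝ) : Prop := ∀ x, v₀ ≤ g.volBall x 1

/-- Condition (c): `sup_M |Riem(g)| < ∞`. -/
def BoundedGeometry (g : RMetric M) : Prop := ∃ C, ∀ x, g.riemNorm x ≤ C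

/-- Condition (c̃) with constants `k`, `m` and base point `b` : (c̃₁) the distance function
`ρ = dist(b,·)` is smooth outside some ball `B_R(b)` (`R > 0`) and `k`-concave (`∇²ρ ≤ k`) there,
and (c̃₂) `sup_{B_r(b)} |Riem| / f(r) → 0` as `r → ∞`, where `f = exp ∘ ⋯ ∘ exp` (`m` times). -/
def CondCTilde (g : RMetric M) (k : ℝ) (m : ℕ) (b : M) : Prop :=
  (∃ R > 0, g.distSmoothOutside b R ∧ ∀ x, R ≤ g.dist b x → g.hessDistUB b x ≤ k) ∧
    Tendsto (fun r => g.riemSupBall b r / iterExp m r) atTop (nhds 0)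

/-- Membership in the class `𝒯(n,k,m,v₀)`: conditions (a), (b) and (c̃)
(the dimension `n` is recorded separately via `IsTopManifoldOfDim`). -/
def InClassT (g : RMetric M) (k : ℝ) (m : ℕ) (v₀ : ℝ) : Prop :=
  g.RicciGE k ∧ g.VolGE v₀ ∧ ∃ b, g.CondCTilde k m b

/-- Membership in the class `𝒯_∞(n,k,v₀)`: conditions (a), (b) and (c). -/
def InClassTInf (g : RMetric M) (k : ℝ) (v₀ : ℝ) : Prop :=
  g.RicciGE k ∧ g.VolGE v₀ ∧ g.BoundedGeometry

end RMetric

/-- `M`, equipped with the topology `τ`, is a topological manifold of dimension `n`. -/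
def IsTopManifoldOfDim (n : ℕ) (M : Type) (τ : TopologicalSpace M) : Prop :=
  Nonempty (@ChartedSpace (EuclideanSpace ℝ (Fin n)) inferInstance M τ)

/-- A pointed `ε`-Gromov–Hausdorff approximation between the `r`-balls about the base points. -/
def PGHApprox {X Y : Type} (dX : X → X → ℝ) (dY : Y → Y → ℝ) (x : X) (y : Y)
    (r ε : ℝ) : Prop :=
  ∃ f : X → Y, f x = y ∧
    (∀ a b : X, dX x a < r → dX x b < r → |dY (f a) (f b) - dX a b| ≤ ε) ∧
    (∀ z : Y, dY y z < r - ε → ∃ a : X, dX x a < r ∧ dY z (f a) ≤ ε)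

/-- Pointed Gromov–Hausdorff convergence of a sequence of pointed distance spaces. -/
def PGHLimitSeq {X : ℕ → Type} {Y : Type} (dX : ∀ i, X i → X i → ℝ) (x : ∀ i, X i)
    (dY : Y → Y → ℝ) (y : Y) : Prop :=
  ∀ r > 0, ∀ ε > 0, ∀ᶠ i in atTop, PGHApprox (dX i) dY (x i) y r ε

/-- Pointed Gromov–Hausdorff convergence of a family of distance functions as `t → 0⁺`. -/
def PGHLimitAtZero {X Y : Type} (dX : ℝ → X → X → ℝ) (x : X) (dY : Y → Y → ℝ)
    (y : Y) : Prop :=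
  ∀ r > 0, ∀ ε > 0, ∀ᶠ t in nhdsWithin 0 (Ioi 0), PGHApprox (dX t) dY x y r ε

/-- An (unpointed) `ε`-Gromov–Hausdorff approximation. -/
def GHApprox {X Y : Type} (dX : X → X → ℝ) (dY : Y → Y → ℝ) (ε : ℝ) : Prop :=
  ∃ f : X → Y, (∀ a b : X, |dY (f a) (f b) - dX a b| ≤ ε) ∧ ∀ z : Y, ∃ a : X, dY z (f a) ≤ ε

/-- Gromov–Hausdorff convergence of a sequence of distance spaces. -/
def GHLimitSeq {X : ℕ → Type} {Y : Type} (dX : ∀ i, X i → X i → ℝ) (dY : Y → Y → ℝ) : Prop :=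
  ∀ ε > 0, ∀ᶠ i in atTop, GHApprox (dX i) dY ε

/-- The a priori estimates (a_t), (b_t), (c_t), (d_t) (with constants `K` and `v₀`) for a
Ricci flow solution `(g t)_{t∈[0,T)}`:
`Ric(g(t)) ≥ -K²`, `vol(B_1(x,t)) ≥ v₀/2`, `sup_M |Riem(g(t))| ≤ K²/t`, and
`e^{K²(t-s)} d(p,q,s) ≥ d(p,q,t) ≥ d(p,q,s) - K²(√t - √s)` for `0 < s ≤ t < T`. -/
def FlowEstimates {M : Type} (g : ℝ → RMetric M) (T K v₀ : ℝ) : Prop :=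
  (∀ t, 0 < t → t < T → (g t).RicciGE (-K ^ 2)) ∧
  (∀ t, 0 < t → t < T → (g t).VolGE (v₀ / 2)) ∧
  (∀ t, 0 < t → t < T → ∀ x, (g t).riemNorm x ≤ K ^ 2 / t) ∧
  (∀ s t, 0 < s → s ≤ t → t < T → ∀ p q : M,
    (g t).dist p q ≤ Real.exp (K ^ 2 * (t - s)) * (g s).dist p q ∧
      (g s).dist p q - K ^ 2 * (Real.sqrt t - Real.sqrt s) ≤ (g t).dist p q)

/-- `hIt m i x = h((x-i)₊⁴)`, where `h = iterExp m` is the exponential comparison function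
`exp ∘ ⋯ ∘ exp` (`m` times) and `a₊ = max a 0`. -/
def hIt (m : ℕ) (i : ℕ) (x : ℝ) : ℝ := iterExp m (max (x - i) 0 ^ 4)

lemma iterExp_succ (m : ℕ) (r : ℝ) : iterExp (m + 1) r = Real.exp (iterExp m r) :=
  Function.iterate_succ_apply' _ _ _

lemma monotone_iterExp (m : ℕ) : Monotone (iterExp m) :=
  Real.exp_monotone.iterate m

lemma iterExp_le_succ (m : ℕ) (r : ℝ) : iterExp m r ≤ iterExp (m + 1) r := by
  rw [iterExp_succ]
  linarith [Real.add_one_le_exp (iterExp m r)]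

lemma le_iterExp (m : ℕ) (r : ℝ) : r ≤ iterExp m r :=
  monotone_nat_of_le_succ (f := fun n => iterExp n r) (fun n => iterExp_le_succ n r) m.zero_le

lemma one_le_iterExp {m : ℕ} (hm : 1 ≤ m) {r : ℝ} (hr : 0 ≤ r) : 1 ≤ iterExp m r := by
  obtain ⟨n, rfl⟩ := Nat.exists_eq_add_of_le' hm
  rw [iterExp_succ]
  exact Real.one_le_exp (hr.trans (le_iterExp n r))

/-- The first derivative of `iterExp m`. -/
def iterExpDeriv : ℕ → ℝ → ℝ
  | 0, _ => 1
  | m + 1, r => iterExp (m + 1) r * iterExpDeriv m r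

/-- The second derivative of `iterExp m`. -/
def iterExpDeriv₂ : ℕ → ℝ → ℝ
  | 0, _ => 0
  | m + 1, r => iterExp (m + 1) r * (iterExpDeriv m r ^ 2 + iterExpDeriv₂ m r)

lemma hasDerivAt_iterExp (m : ℕ) (r : ℝ) : HasDerivAt (iterExp m) (iterExpDeriv m r) r := by
  induction m with
  | zero => exact hasDerivAt_id r
  | succ m ih =>
    have h : iterExp (m + 1) = fun x => Real.exp (iterExp m x) := funext (iterExp_succ m)
    rw [iterExpDeriv, h]
    exact ih.exp

lemma hasDerivAt_iterExpDeriv (m : ℕ) (r : ℝ) :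
    HasDerivAt (iterExpDeriv m) (iterExpDeriv₂ m r) r := by
  induction m with
  | zero => exact hasDerivAt_const r 1
  | succ m ih =>
    refine ((hasDerivAt_iterExp (m + 1) r).mul ih).congr_deriv ?_
    simp only [iterExpDeriv, iterExpDeriv₂]
    ring

lemma iterExpDeriv_nonneg (m : ℕ) {r : ℝ} (hr : 0 ≤ r) : 0 ≤ iterExpDeriv m r := by
  induction m with
  | zero => exact zero_le_one
  | succ m ih => exact mul_nonneg (hr.trans (le_iterExp _ r)) ih

lemma iterExpDeriv₂_nonneg (m : ℕ) {r : ℝ} (hr : 0 ≤ r) : 0 ≤ iterExpDeriv₂ m r := by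
  induction m with
  | zero => exact le_rfl
  | succ m ih => exact mul_nonneg (hr.trans (le_iterExp _ r)) (add_nonneg (sq_nonneg _) ih)

lemma iterExpDeriv_le (m : ℕ) {r : ℝ} (hr : 0 ≤ r) : iterExpDeriv m r ≤ iterExp m r ^ m := by
  induction m with
  | zero => simp [iterExpDeriv]
  | succ m ih =>
    have h₀ : 0 ≤ iterExp m r := hr.trans (le_iterExp _ r)
    have h₁ : 0 ≤ iterExp (m + 1) r := hr.trans (le_iterExp _ r)
    rw [iterExpDeriv, pow_succ']
    gcongr
    exact ih.trans (pow_le_pow_left₀ h₀ (iterExp_le_succ m r) m)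

lemma iterExpDeriv₂_le (m : ℕ) {r : ℝ} (hr : 0 ≤ r) :
    iterExpDeriv₂ m r ≤ m * iterExp m r ^ (2 * m) := by
  induction m with
  | zero => simp [iterExpDeriv₂]
  | succ m ih =>
    have h₀ : 0 ≤ iterExp m r := hr.trans (le_iterExp _ r)
    have h₁ : 1 ≤ iterExp (m + 1) r := one_le_iterExp m.succ_pos hr
    have hsq : iterExpDeriv m r ^ 2 ≤ iterExp m r ^ (2 * m) := by
      rw [mul_comm, pow_mul]
      exact pow_le_pow_left₀ (iterExpDeriv_nonneg m hr) (iterExpDeriv_le m hr) 2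
    calc iterExpDeriv₂ (m + 1) r
        ≤ iterExp (m + 1) r * (((m + 1 : ℕ) : ℝ) * iterExp m r ^ (2 * m)) := by
          rw [iterExpDeriv₂]
          gcongr
          push_cast
          linarith
      _ ≤ iterExp (m + 1) r * (((m + 1 : ℕ) : ℝ) * iterExp (m + 1) r ^ (2 * m)) := by
          gcongr
          exact iterExp_le_succ m r
      _ = ((m + 1 : ℕ) : ℝ) * iterExp (m + 1) r ^ (2 * m + 1) := by ring
      _ ≤ ((m + 1 : ℕ) : ℝ) * iterExp (m + 1) r ^ (2 * (m + 1)) := by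
          gcongr
          omega

lemma pow_le_mul_exp {k : ℝ} (hk : 0 < k) (n : ℕ) {x : ℝ} (hx : 0 ≤ x) :
    x ^ n ≤ n.factorial / k ^ n * Real.exp (k * x) := by
  have h := Real.pow_div_factorial_le_exp (k * x) (by positivity) n
  rw [div_le_iff₀ (by positivity), mul_pow] at h
  rw [div_mul_eq_mul_div, le_div_iff₀ (by positivity)]
  linarith

lemma sum_rpow_iterExp_le {m : ℕ} (hm : 1 ≤ m) {p : ℝ} (hp : 0 ≤ p) {r : ℝ} (hr : 0 ≤ r) :
    |r| ^ p + |iterExp m r| ^ p + |deriv (iterExp m) r| ^ p +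
      |deriv (deriv (iterExp m)) r| ^ p ≤
        4 * (m : ℝ) ^ ⌈p⌉₊ * iterExp m r ^ (2 * m * ⌈p⌉₊) := by
  have hm' : (1 : ℝ) ≤ m := by exact_mod_cast hm
  have h₁ : 1 ≤ iterExp m r := one_le_iterExp hm hr
  have hpow : ∀ j ≤ 2 * m, iterExp m r ^ j ≤ m * iterExp m r ^ (2 * m) := fun j hj =>
    (pow_le_pow_right₀ h₁ hj).trans (le_mul_of_one_le_left (by positivity) hm')
  have hB : 1 ≤ m * iterExp m r ^ (2 * m) := by simpa using hpow 0 (by omega)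
  have hh : iterExp m r ≤ m * iterExp m r ^ (2 * m) := by simpa using hpow 1 (by omega)
  have key : ∀ x : ℝ, 0 ≤ x → x ≤ m * iterExp m r ^ (2 * m) →
      |x| ^ p ≤ (m : ℝ) ^ ⌈p⌉₊ * iterExp m r ^ (2 * m * ⌈p⌉₊) := by
    intro x hx hxB
    rw [abs_of_nonneg hx, pow_mul, ← mul_pow, ← Real.rpow_natCast]
    exact (Real.rpow_le_rpow hx hxB hp).trans (Real.rpow_le_rpow_of_exponent_le hB (Nat.le_ceil p))
  have hd : deriv (iterExp m) = iterExpDeriv m := funext fun x => (hasDerivAt_iterExp m x).deriv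
  rw [hd, (hasDerivAt_iterExpDeriv m r).deriv]
  have e₁ := key r hr ((le_iterExp m r).trans hh)
  have e₂ := key _ (by linarith) hh
  have e₃ := key _ (iterExpDeriv_nonneg m hr) ((iterExpDeriv_le m hr).trans (hpow m (by omega)))
  have e₄ := key _ (iterExpDeriv₂_nonneg m hr) (iterExpDeriv₂_le m hr)
  linarith

lemma hIt_of_lt (m : ℕ) {i : ℕ} {y : ℝ} (hy : (i : ℝ) < y) :
    hIt m i y = iterExp m ((y - i) ^ 4) := by
  rw [hIt, max_eq_left (by linarith)]

lemma one_le_hIt {m : ℕ} (hm : 1 ≤ m) (i : ℕ) (y : ℝ) : 1 ≤ hIt m i y :=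
  one_le_iterExp hm (by positivity)

lemma hasDerivAt_sub_pow (a : ℝ) (n : ℕ) (y : ℝ) :
    HasDerivAt (fun z : ℝ => (z - a) ^ n) (n * (y - a) ^ (n - 1)) y := by
  simpa using ((hasDerivAt_id' y).sub_const a).fun_pow n

lemma hasDerivAt_hIt (m : ℕ) {i : ℕ} {y : ℝ} (hy : (i : ℝ) < y) :
    HasDerivAt (hIt m i) (iterExpDeriv m ((y - i) ^ 4) * (4 * (y - i) ^ 3)) y := by
  refine ((hasDerivAt_iterExp m ((y - i) ^ 4)).comp y (hasDerivAt_sub_pow _ 4 y)).congr_of_eventuallyEq ?_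
  filter_upwards [lt_mem_nhds hy] with z hz using hIt_of_lt m hz

lemma deriv_deriv_hIt (m : ℕ) {i : ℕ} {y : ℝ} (hy : (i : ℝ) < y) :
    deriv (deriv (hIt m i)) y =
      iterExpDeriv₂ m ((y - i) ^ 4) * (16 * (y - i) ^ 6) +
        iterExpDeriv m ((y - i) ^ 4) * (12 * (y - i) ^ 2) := by
  have h := ((hasDerivAt_iterExpDeriv m ((y - i) ^ 4)).comp y (hasDerivAt_sub_pow _ 4 y)).mul
    ((hasDerivAt_sub_pow (i : ℝ) 3 y).const_mul 4)
  refine (h.congr_of_eventuallyEq ?_).deriv.trans ?_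
  · filter_upwards [lt_mem_nhds hy] with z hz using (hasDerivAt_hIt m hz).deriv
  · simp only [Function.comp_apply]
    ring

lemma deriv_hIt_of_le (m : ℕ) {i : ℕ} {y : ℝ} (hy : y ≤ i) : deriv (hIt m i) y = 0 := by
  refine IsLocalMin.deriv_eq_zero (Eventually.of_forall fun z => monotone_iterExp m ?_)
  rw [max_eq_right (by linarith), zero_pow four_ne_zero]
  positivity

lemma sub_le_hIt {m : ℕ} (hm : 1 ≤ m) {i : ℕ} {y : ℝ} (hy : (i : ℝ) < y) :
    y - i ≤ hIt m i y := by
  rcases le_total (y - i) 1 with h | h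
  · exact h.trans (one_le_hIt hm i y)
  · rw [hIt_of_lt m hy]
    exact (le_self_pow₀ h (by norm_num)).trans (le_iterExp m _)

lemma abs_deriv_hIt_le {m : ℕ} (hm : 1 ≤ m) (i : ℕ) (y : ℝ) :
    |deriv (hIt m i) y| ≤ 4 * hIt m i y ^ (m + 3) := by
  have h₁ := one_le_hIt hm i y
  rcases le_or_gt y i with hy | hy
  · rw [deriv_hIt_of_le m hy, abs_zero]
    positivity
  · have hx : 0 < y - i := sub_pos.2 hy
    have hd₀ := iterExpDeriv_nonneg m (r := (y - i) ^ 4) (by positivity)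
    have hd := iterExpDeriv_le m (r := (y - i) ^ 4) (by positivity)
    rw [← hIt_of_lt m hy] at hd
    rw [(hasDerivAt_hIt m hy).deriv, abs_of_nonneg (by positivity)]
    calc iterExpDeriv m ((y - i) ^ 4) * (4 * (y - i) ^ 3)
        ≤ hIt m i y ^ m * (4 * hIt m i y ^ 3) := by
          gcongr
          exact sub_le_hIt hm hy
      _ = 4 * hIt m i y ^ (m + 3) := by ring

lemma abs_deriv_deriv_hIt_le {m : ℕ} (hm : 1 ≤ m) {i : ℕ} {y : ℝ} (hy : (i : ℝ) < y) :
    |deriv (deriv (hIt m i)) y| ≤ (16 * m + 12) * hIt m i y ^ (2 * m + 6) := by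
  have h₁ := one_le_hIt hm i y
  have hx : 0 < y - i := sub_pos.2 hy
  have hxh := sub_le_hIt hm hy
  have hd₀ := iterExpDeriv_nonneg m (r := (y - i) ^ 4) (by positivity)
  have hd := iterExpDeriv_le m (r := (y - i) ^ 4) (by positivity)
  have hdd₀ := iterExpDeriv₂_nonneg m (r := (y - i) ^ 4) (by positivity)
  have hdd := iterExpDeriv₂_le m (r := (y - i) ^ 4) (by positivity)
  rw [← hIt_of_lt m hy] at hd hdd
  rw [deriv_deriv_hIt m hy, abs_of_nonneg (by positivity)]
  calc iterExpDeriv₂ m ((y - i) ^ 4) * (16 * (y - i) ^ 6) +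
        iterExpDeriv m ((y - i) ^ 4) * (12 * (y - i) ^ 2)
      ≤ m * hIt m i y ^ (2 * m) * (16 * hIt m i y ^ 6) +
        hIt m i y ^ m * (12 * hIt m i y ^ 2) := by gcongr
    _ = 16 * m * hIt m i y ^ (2 * m + 6) + 12 * hIt m i y ^ (m + 2) := by ring
    _ ≤ 16 * m * hIt m i y ^ (2 * m + 6) + 12 * hIt m i y ^ (2 * m + 6) := by
        gcongr <;> omega
    _ = (16 * m + 12) * hIt m i y ^ (2 * m + 6) := by ring

/-- Lemma 7.3.  Let `h = exp ∘ ⋯ ∘ exp` (`m ≥ 1` times) be an exponential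
comparison function, let `k > 0` and `p ≥ 0` be real numbers, and for `i ∈ ℕ` let
`hᵢ(x) := h(((x-i)₊)⁴)`.  Then there exist constants `c_{k,p}` (depending on `k`, `p` and `h`)
and `c_k` (depending on `k` and `h`), but NOT on `i`, such that:
`|r|^p + |h(r)|^p + |h'(r)|^p + |h''(r)|^p ≤ c_{k,p} e^{k h(r)}` for all `r ≥ 0`;
`|hᵢ(y)| ≤ c_k e^{k hᵢ(y)}` and `|hᵢ'(y)| ≤ c_k e^{k hᵢ(y)}` for all `y ≥ 0`; and
`|hᵢ''(y)| ≤ c_k e^{k hᵢ(y)}` for all `y > i`. -/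
theorem statement9 (m : ℕ) (hm : 1 ≤ m) (k p : ℝ) (hk : 0 < k) (hp : 0 ≤ p) :
    ∃ ckp ck : ℝ,
      (∀ r : ℝ, 0 ≤ r →
        |r| ^ p + |iterExp m r| ^ p + |deriv (iterExp m) r| ^ p +
          |deriv (deriv (iterExp m)) r| ^ p ≤ ckp * Real.exp (k * iterExp m r)) ∧
      ∀ i : ℕ,
        (∀ y : ℝ, 0 ≤ y → |hIt m i y| ≤ ck * Real.exp (k * hIt m i y)) ∧
        (∀ y : ℝ, 0 ≤ y → |deriv (hIt m i) y| ≤ ck * Real.exp (k * hIt m i y)) ∧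
        (∀ y : ℝ, (i : ℝ) < y →
          |deriv (deriv (hIt m i)) y| ≤ ck * Real.exp (k * hIt m i y)) := by
  refine ⟨4 * (m : ℝ) ^ ⌈p⌉₊ * ((2 * m * ⌈p⌉₊).factorial / k ^ (2 * m * ⌈p⌉₊)),
    (16 * m + 12) * ((2 * m + 6).factorial / k ^ (2 * m + 6)), fun r hr => ?_, fun i => ?_⟩
  · refine (sum_rpow_iterExp_le hm hp hr).trans ?_
    rw [mul_assoc (4 * (m : ℝ) ^ ⌈p⌉₊) (_ / _)]
    gcongr
    exact pow_le_mul_exp hk _ (hr.trans (le_iterExp m r))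
  · have bound : ∀ y : ℝ, (16 * m + 12) * hIt m i y ^ (2 * m + 6) ≤
        (16 * m + 12) * ((2 * m + 6).factorial / k ^ (2 * m + 6)) *
          Real.exp (k * hIt m i y) := fun y => by
      rw [mul_assoc (16 * (m : ℝ) + 12)]
      gcongr
      exact pow_le_mul_exp hk _ (zero_le_one.trans (one_le_hIt hm i y))
    have weaken : ∀ (y : ℝ) (c : ℝ) (j : ℕ), c ≤ 12 → j ≤ 2 * m + 6 →
        c * hIt m i y ^ j ≤ (16 * m + 12) * hIt m i y ^ (2 * m + 6) := fun y c j hc hj => by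
      have h₁ := one_le_hIt hm i y
      have hm₀ : (0 : ℝ) ≤ m := m.cast_nonneg
      exact mul_le_mul (by linarith) (pow_le_pow_right₀ h₁ hj) (by positivity) (by positivity)
    refine ⟨fun y _ => ?_, fun y _ => ?_, fun y hy => ?_⟩
    · rw [abs_of_nonneg (zero_le_one.trans (one_le_hIt hm i y))]
      refine le_trans ?_ (bound y)
      simpa using weaken y 1 1 (by norm_num) (by omega)
    · exact (abs_deriv_hIt_le hm i y).trans
        ((weaken y 4 (m + 3) (by norm_num) (by omega)).trans (bound y))
    · exact (abs_deriv_deriv_hIt_le hm hy).trans (bound y)
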